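/- Let k ≥ 2 and let β_k denote the permutation 2 3 ⋯ k 1 of size k. For a permutation σ let G_σ denote the formal power series over ℚ whose n-th coefficient is the number of permutations of size n avoiding all of 312, 321 and σ. Then (1 − X)²·G_{21⊕β_k} = (1 − X) + X²·G_{β_k}. -/

import Mathlib

/-- `l` is the one-line notation of a permutation of `{1, …, l.length}`. -/
def IsPermList (l : List ℕ) : Prop :=
  l.Perm ((List.range l.length).map (· + 1))

/-- `Involves σ τ` means the permutation (in one-line notation) `σ` is involved in `τ`
(written σ ≼ τ): there is a strictly increasing map of positions matching relative order. -/
def Involves (σ τ : List ℕ) : Prop :=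
  ∃ f : Fin σ.length → Fin τ.length, StrictMono f ∧
    ∀ i j : Fin σ.length, σ.get i < σ.get j ↔ τ.get (f i) < τ.get (f j)

/-- Direct sum `σ ⊕ τ` of permutations in one-line notation. -/
def dsum (σ τ : List ℕ) : List ℕ := σ ++ τ.map (· + σ.length)

/-- `β_k = 2 3 ⋯ k 1`, in one-line notation. -/
def beta (k : ℕ) : List ℕ := (List.range (k - 1)).map (· + 2) ++ [1]

/-- The generating function (over ℚ) of permutations avoiding `312`, `321` and `σ`. -/
noncomputable def Gav (σ : List ℕ) : PowerSeries ℚ :=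
  PowerSeries.mk fun n =>
    (Nat.card {l : List ℕ // l.length = n ∧ IsPermList l ∧
        ¬ Involves [3, 1, 2] l ∧ ¬ Involves [3, 2, 1] l ∧ ¬ Involves σ l} : ℚ)

/-- Two lists of the same length whose entries are in the same relative order. -/
def OrderIsomorphic (σ s : List ℕ) : Prop :=
  σ.length = s.length ∧ ∀ i j, (hi : i < σ.length) → (hj : j < σ.length) →
    (hi' : i < s.length) → (hj' : j < s.length) → (σ[i] < σ[j] ↔ s[i] < s[j])

theorem orderIsomorphic_map_right {σ s : List ℕ} {g : ℕ → ℕ} (hg : StrictMono g) :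
    OrderIsomorphic σ (s.map g) ↔ OrderIsomorphic σ s := by
  simp [OrderIsomorphic, hg.lt_iff_lt]

theorem orderIsomorphic_map_left {σ s : List ℕ} {g : ℕ → ℕ} (hg : StrictMono g) :
    OrderIsomorphic (σ.map g) s ↔ OrderIsomorphic σ s := by
  simp [OrderIsomorphic, hg.lt_iff_lt]

theorem orderIsomorphic_cons {a b : ℕ} {σ s : List ℕ} :
    OrderIsomorphic (a :: σ) (b :: s) ↔ OrderIsomorphic σ s ∧
      ∀ i, (hi : i < σ.length) → (hi' : i < s.length) →
        (a < σ[i] ↔ b < s[i]) ∧ (σ[i] < a ↔ s[i] < b) := by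
  constructor
  · rintro ⟨hl, h⟩
    refine ⟨⟨by simpa using hl, fun i j hi hj hi' hj' => ?_⟩, fun i hi hi' => ⟨?_, ?_⟩⟩
    · exact h (i + 1) (j + 1) (by simpa) (by simpa) (by simpa) (by simpa)
    · exact h 0 (i + 1) (by simp) (by simpa) (by simp) (by simpa)
    · exact h (i + 1) 0 (by simpa) (by simp) (by simpa) (by simp)
  · rintro ⟨⟨hl, h⟩, h'⟩
    refine ⟨by simpa using hl, fun i j hi hj hi' hj' => ?_⟩
    rcases i with _ | i <;> rcases j with _ | j
    · simp
    · simpa using (h' j (by simpa using hj) (by simpa using hj')).1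
    · simpa using (h' i (by simpa using hi) (by simpa using hi')).2
    · simpa using h i j (by simpa using hi) (by simpa using hj) (by simpa using hi')
        (by simpa using hj')

theorem involves_iff_exists_sublist {σ l : List ℕ} :
    Involves σ l ↔ ∃ s, s.Sublist l ∧ OrderIsomorphic σ s := by
  constructor
  · rintro ⟨f, hf, h⟩
    refine ⟨List.ofFn fun i => l.get (f i), ?_, by simp, fun i j hi hj _ _ => ?_⟩
    · rw [List.sublist_iff_exists_fin_orderEmbedding_get_eq]
      refine ⟨OrderEmbedding.ofStrictMono (fun i => f (i.cast (by simp)))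
        (fun i j hij => hf (by simpa using hij)), fun i => by simp; rfl⟩
    · simpa using h ⟨i, hi⟩ ⟨j, hj⟩
  · rintro ⟨s, hs, hl, h⟩
    rw [List.sublist_iff_exists_fin_orderEmbedding_get_eq] at hs
    obtain ⟨f, hf⟩ := hs
    refine ⟨fun i => f (i.cast hl), fun i j hij => f.strictMono (by simpa using hij),
      fun i j => ?_⟩
    rw [← hf, ← hf]
    simpa using h i j i.2 j.2 (hl ▸ i.2) (hl ▸ j.2)

/-- A pattern `21 ⊕ σ` occurs in `l`: a descent `x y` followed by larger entries forming `σ`. -/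
def InvolvesDescentThen (σ l : List ℕ) : Prop :=
  ∃ x y r, (x :: y :: r).Sublist l ∧ y < x ∧ (∀ z ∈ r, x < z) ∧ OrderIsomorphic σ r

theorem involves_dsum_iff {σ l : List ℕ} (hσ : ∀ a ∈ σ, 0 < a) :
    Involves (dsum [2, 1] σ) l ↔ InvolvesDescentThen σ l := by
  have hmono : StrictMono (· + 2 : ℕ → ℕ) := fun a b h => by simpa using h
  rw [involves_iff_exists_sublist]
  constructor
  · rintro ⟨s, hs, h⟩
    have hl := h.1
    obtain _ | ⟨x, _ | ⟨y, r⟩⟩ := s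
    · simp [dsum] at hl
    · simp [dsum] at hl
    · simp only [dsum, List.cons_append, List.nil_append, orderIsomorphic_cons] at h
      obtain ⟨⟨h1, h2⟩, h3⟩ := h
      refine ⟨x, y, r, hs, ?_, ?_, (orderIsomorphic_map_left hmono).1 h1⟩
      · exact ((h3 0 (by simp) (by simp)).2.1 (by simp))
      · intro z hz
        obtain ⟨i, hi, rfl⟩ := List.getElem_of_mem hz
        have hi' : i < σ.length := by have := h1.1; simp at this; omega
        refine (h3 (i + 1) (by simpa) (by simpa)).1.1 ?_
        simpa using hσ _ (List.getElem_mem hi')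
  · rintro ⟨x, y, r, hs, hyx, hr, h⟩
    refine ⟨_, hs, ?_⟩
    simp only [dsum, List.cons_append, List.nil_append, orderIsomorphic_cons]
    refine ⟨⟨(orderIsomorphic_map_left hmono).2 h, fun i hi hi' => ?_⟩, fun i hi hi' => ?_⟩
    · have hi : i < σ.length := by simpa using hi
      have h1 := hσ σ[i] (List.getElem_mem hi)
      have h2 := hr r[i] (List.getElem_mem hi')
      simp only [List.getElem_map, List.length_cons, List.length_nil]
      omega
    · rcases i with _ | i
      · simp; omega
      · have hi : i < σ.length := by simpa using hi
        have hi' : i < r.length := by simpa using hi'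
        have h1 := hσ σ[i] (List.getElem_mem hi)
        have h2 := hr r[i] (List.getElem_mem hi')
        simp only [List.getElem_cons_succ, List.getElem_map, List.length_cons, List.length_nil]
        omega

/-- Some entry of `l` is followed by two smaller entries. -/
def HasTwoSmallerAfter (l : List ℕ) : Prop :=
  ∃ x y z, [x, y, z].Sublist l ∧ y < x ∧ z < x

theorem involves_triple_iff {a b c : ℕ} {l : List ℕ} :
    Involves [a, b, c] l ↔ ∃ x y z, [x, y, z].Sublist l ∧ (a < b ↔ x < y) ∧ (b < a ↔ y < x) ∧
      (a < c ↔ x < z) ∧ (c < a ↔ z < x) ∧ (b < c ↔ y < z) ∧ (c < b ↔ z < y) := by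
  rw [involves_iff_exists_sublist]
  constructor
  · rintro ⟨s, hs, h⟩
    have hl := h.1
    obtain _ | ⟨x, _ | ⟨y, _ | ⟨z, _ | ⟨w, r⟩⟩⟩⟩ := s <;> simp at hl
    have h := h.2
    exact ⟨x, y, z, hs, h 0 1 (by simp) (by simp) (by simp) (by simp),
      h 1 0 (by simp) (by simp) (by simp) (by simp), h 0 2 (by simp) (by simp) (by simp) (by simp),
      h 2 0 (by simp) (by simp) (by simp) (by simp), h 1 2 (by simp) (by simp) (by simp) (by simp),
      h 2 1 (by simp) (by simp) (by simp) (by simp)⟩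
  · rintro ⟨x, y, z, hs, h1, h2, h3, h4, h5, h6⟩
    refine ⟨_, hs, rfl, fun i j hi hj _ _ => ?_⟩
    simp only [List.length_cons, List.length_nil] at hi hj
    interval_cases i <;> interval_cases j <;> first | assumption | simp

theorem avoids_312_and_321_iff {l : List ℕ} (hl : l.Nodup) :
    (¬ Involves [3, 1, 2] l ∧ ¬ Involves [3, 2, 1] l) ↔ ¬ HasTwoSmallerAfter l := by
  rw [← not_or, not_iff_not]
  simp only [involves_triple_iff]
  constructor
  · rintro (⟨x, y, z, hs, h⟩ | ⟨x, y, z, hs, h⟩) <;> exact ⟨x, y, z, hs, by omega, by omega⟩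
  · rintro ⟨x, y, z, hs, h1, h2⟩
    have hyz : y ≠ z := by
      have := hs.nodup hl
      simp at this
      tauto
    rcases lt_or_gt_of_ne hyz with h | h
    · exact .inl ⟨x, y, z, hs, by omega⟩
    · exact .inr ⟨x, y, z, hs, by omega⟩

theorem isPermList_iff {l : List ℕ} :
    IsPermList l ↔ l.Nodup ∧ ∀ x, x ∈ l ↔ 1 ≤ x ∧ x ≤ l.length := by
  have hnd : ((List.range l.length).map (· + 1)).Nodup :=
    List.nodup_range.map (fun a b h => by simpa using h)
  have hmem (x : ℕ) : x ∈ (List.range l.length).map (· + 1) ↔ 1 ≤ x ∧ x ≤ l.length := by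
    simp only [List.mem_map, List.mem_range]
    exact ⟨by rintro ⟨a, h, rfl⟩; omega, fun h => ⟨x - 1, by omega, by omega⟩⟩
  constructor
  · intro h
    exact ⟨h.nodup_iff.2 hnd, fun x => by rw [h.mem_iff, hmem]⟩
  · rintro ⟨h1, h2⟩
    exact (List.perm_ext_iff_of_nodup h1 hnd).2 fun x => by rw [h2, hmem]

/-- The increasing map onto the naturals different from `c`. -/
def skip (c x : ℕ) : ℕ := if x < c then x else x + 1

theorem skip_strictMono (c : ℕ) : StrictMono (skip c) := by
  intro a b h
  unfold skip
  split_ifs <;> omega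

/-- Prepend the value `c` to a permutation, shifting up the entries that are at least `c`. -/
def consValue (c : ℕ) (t : List ℕ) : List ℕ := c :: t.map (skip c)

theorem consValue_injective (c : ℕ) : Function.Injective (consValue c) := by
  intro s t h
  exact (skip_strictMono c).injective.list_map (List.cons.inj h).2

theorem isPermList_consValue {c : ℕ} {t : List ℕ} (hc : 1 ≤ c) (hct : c ≤ t.length + 1) :
    IsPermList (consValue c t) ↔ IsPermList t := by
  have hskip (x : ℕ) : skip c x ≠ c := by unfold skip; split_ifs <;> omega
  simp only [isPermList_iff, consValue, List.nodup_cons, List.mem_map, List.length_cons,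
    List.length_map, List.mem_cons, List.nodup_map_iff (skip_strictMono c).injective]
  constructor
  · rintro ⟨⟨_, h1⟩, h2⟩
    refine ⟨h1, fun x => ?_⟩
    have := h2 (skip c x)
    simp only [hskip, false_or, (skip_strictMono c).injective.eq_iff, exists_eq_right] at this
    rw [this]
    unfold skip
    split_ifs <;> omega
  · rintro ⟨h1, h2⟩
    refine ⟨⟨by simp [hskip], h1⟩, fun x => ?_⟩
    constructor
    · rintro (rfl | ⟨a, ha, rfl⟩)
      · omega
      · rw [h2] at ha
        unfold skip
        split_ifs <;> omega
    · intro hx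
      rcases lt_trichotomy x c with h | h | h
      · exact .inr ⟨x, (h2 x).2 (by omega), by simp [skip, h]⟩
      · exact .inl h
      · exact .inr ⟨x - 1, (h2 _).2 (by omega), by unfold skip; split_ifs <;> omega⟩

theorem IsPermList.exists_eq_consValue {c : ℕ} {t : List ℕ} (h : IsPermList (c :: t)) :
    ∃ s, c :: t = consValue c s ∧ IsPermList s := by
  obtain ⟨hnd, hmem⟩ := isPermList_iff.1 h
  have hct : c ∉ t := (List.nodup_cons.1 hnd).1
  have hc := (hmem c).1 (by simp)
  have heq : c :: t = consValue c (t.map fun x => if x < c then x else x - 1) := by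
    simp only [consValue, List.map_map, List.cons.injEq, true_and]
    refine (List.map_congr_left fun x hx => ?_).symm.trans (List.map_id t) |>.symm
    have : x ≠ c := fun h => hct (h ▸ hx)
    simp only [Function.comp, skip, id]
    split_ifs <;> omega
  refine ⟨_, heq, ?_⟩
  rw [← isPermList_consValue hc.1 (by simpa using hc.2), ← heq]
  exact h

theorem pair_sublist_or {α : Type*} {a b : α} {t : List α} (ha : a ∈ t) (hb : b ∈ t)
    (hab : a ≠ b) : [a, b].Sublist t ∨ [b, a].Sublist t := by
  induction t with
  | nil => simp at ha
  | cons x t ih =>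
    rcases List.mem_cons.1 ha with rfl | ha' <;> rcases List.mem_cons.1 hb with rfl | hb'
    · exact absurd rfl hab
    · exact .inl ((List.singleton_sublist.2 hb').cons_cons a)
    · exact .inr ((List.singleton_sublist.2 ha').cons_cons b)
    · exact (ih ha' hb').imp (·.cons x) (·.cons x)

/-- The permutations avoiding `312` and `321`. -/
def AvoidsBoth (l : List ℕ) : Prop := IsPermList l ∧ ¬ HasTwoSmallerAfter l

theorem AvoidsBoth.head_le_two {c : ℕ} {t : List ℕ} (h : AvoidsBoth (c :: t)) : c = 1 ∨ c = 2 := by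
  obtain ⟨hnd, hmem⟩ := isPermList_iff.1 h.1
  by_contra hc
  have hc1 := (hmem c).1 (by simp)
  have h1 : 1 ∈ t := by
    have := (hmem 1).2 (by omega)
    exact (List.mem_cons.1 this).resolve_left (by omega)
  have h2 : 2 ∈ t := by
    have := (hmem 2).2 (by omega)
    exact (List.mem_cons.1 this).resolve_left (by omega)
  rcases pair_sublist_or h1 h2 (by simp) with h3 | h3
  · exact h.2 ⟨c, 1, 2, h3.cons_cons c, by omega, by omega⟩
  · exact h.2 ⟨c, 2, 1, h3.cons_cons c, by omega, by omega⟩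

theorem HasTwoSmallerAfter.map_iff {t : List ℕ} {g : ℕ → ℕ} (hg : StrictMono g) :
    HasTwoSmallerAfter (t.map g) ↔ HasTwoSmallerAfter t := by
  constructor
  · rintro ⟨x, y, z, hs, h1, h2⟩
    obtain ⟨s, hs', he⟩ := List.sublist_map_iff.1 hs
    obtain _ | ⟨x', _ | ⟨y', _ | ⟨z', _ | _⟩⟩⟩ := s <;> simp at he
    obtain ⟨rfl, rfl, rfl⟩ := he
    exact ⟨x', y', z', hs', hg.lt_iff_lt.1 h1, hg.lt_iff_lt.1 h2⟩
  · rintro ⟨x, y, z, hs, h1, h2⟩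
    exact ⟨g x, g y, g z, by simpa using hs.map g, hg h1, hg h2⟩

theorem avoidsBoth_consValue {c : ℕ} {t : List ℕ} (hc : c = 1 ∨ c = 2) (hct : c ≤ t.length + 1) :
    AvoidsBoth (consValue c t) ↔ AvoidsBoth t := by
  have hp := isPermList_consValue (by omega : 1 ≤ c) hct
  unfold AvoidsBoth
  rw [hp]
  refine and_congr_right fun ht => not_congr ?_
  rw [← HasTwoSmallerAfter.map_iff (skip_strictMono c) (t := t)]
  constructor
  · rintro ⟨x, y, z, hs, h1, h2⟩
    obtain ⟨hnd, hmem⟩ := isPermList_iff.1 (hp.2 ht)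
    have hnd' := hs.nodup hnd
    have hy := (hmem y).1 (hs.subset (by simp))
    have hz := (hmem z).1 (hs.subset (by simp))
    rcases List.cons_sublist_cons'.1 hs with hs | ⟨rfl, hs⟩
    · exact ⟨x, y, z, hs, h1, h2⟩
    · simp at hnd'
      omega
  · rintro ⟨x, y, z, hs, h⟩
    exact ⟨x, y, z, hs.cons c, h⟩

theorem InvolvesDescentThen.map_iff {σ t : List ℕ} {g : ℕ → ℕ} (hg : StrictMono g) :
    InvolvesDescentThen σ (t.map g) ↔ InvolvesDescentThen σ t := by
  constructor
  · rintro ⟨x, y, r, hs, h1, h2, h3⟩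
    obtain ⟨s, hs', he⟩ := List.sublist_map_iff.1 hs
    obtain _ | ⟨x', _ | ⟨y', r'⟩⟩ := s <;> simp at he
    obtain ⟨rfl, rfl, rfl⟩ := he
    refine ⟨x', y', r', hs', hg.lt_iff_lt.1 h1, fun z hz => hg.lt_iff_lt.1 (h2 _ ?_),
      (orderIsomorphic_map_right hg).1 h3⟩
    exact List.mem_map_of_mem hz
  · rintro ⟨x, y, r, hs, h1, h2, h3⟩
    refine ⟨g x, g y, r.map g, by simpa using hs.map g, hg h1, ?_,
      (orderIsomorphic_map_right hg).2 h3⟩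
    simpa using fun a ha => hg (h2 a ha)

theorem InvolvesDescentThen.cons {σ t : List ℕ} (c : ℕ) (h : InvolvesDescentThen σ t) :
    InvolvesDescentThen σ (c :: t) := by
  obtain ⟨x, y, r, hs, h⟩ := h
  exact ⟨x, y, r, hs.cons c, h⟩

theorem involvesDescentThen_consValue_one {σ t : List ℕ} (ht : IsPermList t) :
    InvolvesDescentThen σ (consValue 1 t) ↔ InvolvesDescentThen σ t := by
  rw [← InvolvesDescentThen.map_iff (skip_strictMono 1) (t := t)]
  refine ⟨?_, fun h => h.cons 1⟩
  rintro ⟨x, y, r, hs, h1, h2⟩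
  obtain ⟨_, hmem⟩ := isPermList_iff.1 ((isPermList_consValue le_rfl (by omega)).2 ht)
  have hy := (hmem y).1 (hs.subset (by simp))
  rcases List.cons_sublist_cons'.1 hs with hs | ⟨rfl, hs⟩
  · exact ⟨x, y, r, hs, h1, h2⟩
  · omega

theorem involvesDescentThen_consValue_two_one {σ t : List ℕ} (ht : IsPermList t) :
    InvolvesDescentThen σ (consValue 2 (consValue 1 t)) ↔ Involves σ t := by
  have hmono : StrictMono (skip 2 ∘ skip 1) := (skip_strictMono 2).comp (skip_strictMono 1)
  have he : consValue 2 (consValue 1 t) = 2 :: 1 :: t.map (skip 2 ∘ skip 1) := by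
    simp [consValue, skip]
  rw [he, involves_iff_exists_sublist]
  constructor
  · rintro ⟨x, y, r, hs, h1, h2, h3⟩
    obtain ⟨s, hs', rfl⟩ := List.sublist_map_iff.1 hs.tail.tail
    exact ⟨s, hs', (orderIsomorphic_map_right hmono).1 h3⟩
  · rintro ⟨s, hs, h⟩
    refine ⟨2, 1, s.map (skip 2 ∘ skip 1), ((hs.map _).cons_cons 1).cons_cons 2, by simp, ?_,
      (orderIsomorphic_map_right hmono).2 h⟩
    simp only [List.mem_map, forall_exists_index, and_imp, forall_apply_eq_imp_iff₂]
    intro a ha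
    have := ((isPermList_iff.1 ht).2 a).1 (hs.subset ha)
    simp only [Function.comp, skip]
    split_ifs <;> omega

theorem involvesDescentThen_consValue_two {σ t : List ℕ} (ht : IsPermList (2 :: t)) :
    InvolvesDescentThen σ (consValue 2 (2 :: t)) ↔ InvolvesDescentThen σ (2 :: t) := by
  have hg := skip_strictMono 2
  constructor
  · rintro ⟨x, y, r, hs, h1, h2, h3⟩
    rcases List.cons_sublist_cons'.1 hs with hs | ⟨rfl, hs'⟩
    · exact (InvolvesDescentThen.map_iff hg).1 ⟨x, y, r, hs, h1, h2, h3⟩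
    · rw [List.map_cons] at hs'
      rcases List.cons_sublist_cons'.1 hs' with hs | ⟨rfl, hs⟩
      · obtain ⟨s, hst, he⟩ := List.sublist_map_iff.1 hs
        obtain _ | ⟨y', r'⟩ := s <;> simp at he
        obtain ⟨rfl, rfl⟩ := he
        refine ⟨2, y', r', hst.cons_cons 2, ?_, fun z hz => ?_,
          (orderIsomorphic_map_right hg).1 h3⟩
        · unfold skip at h1
          split_ifs at h1 <;> omega
        · have hz2 : z ≠ 2 := by
            rintro rfl
            exact (List.nodup_cons.1 (isPermList_iff.1 ht).1).1 (hst.subset (by simp [hz]))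
          have := h2 (skip 2 z) (List.mem_map_of_mem hz)
          unfold skip at this
          split_ifs at this <;> omega
      · simp [skip] at h1
  · intro h
    exact ((InvolvesDescentThen.map_iff hg).2 h).cons 2

/-- Permutations of size `n` avoiding `312`, `321` and `σ`. -/
def avoiders (σ : List ℕ) (n : ℕ) : Set (List ℕ) :=
  {l | l.length = n ∧ AvoidsBoth l ∧ ¬ Involves σ l}

/-- Permutations of size `n` avoiding `312`, `321` and `21 ⊕ σ`. -/
def descentAvoiders (σ : List ℕ) (n : ℕ) : Set (List ℕ) :=
  {l | l.length = n ∧ AvoidsBoth l ∧ ¬ InvolvesDescentThen σ l}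

/-- The permutations in `descentAvoiders σ n` that start with `2`. -/
def descentAvoidersTwo (σ : List ℕ) (n : ℕ) : Set (List ℕ) :=
  {l | l ∈ descentAvoiders σ n ∧ ∃ t, l = 2 :: t}

theorem finite_isPermList (n : ℕ) : {l : List ℕ | l.length = n ∧ IsPermList l}.Finite := by
  refine (List.finite_toSet ((List.range n).map (· + 1)).permutations).subset ?_
  rintro l ⟨rfl, h⟩
  exact List.mem_permutations.2 h

theorem finite_avoiders (σ : List ℕ) (n : ℕ) : (avoiders σ n).Finite :=
  (finite_isPermList n).subset fun _ h => ⟨h.1, h.2.1.1⟩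

theorem finite_descentAvoiders (σ : List ℕ) (n : ℕ) : (descentAvoiders σ n).Finite :=
  (finite_isPermList n).subset fun _ h => ⟨h.1, h.2.1.1⟩

theorem finite_descentAvoidersTwo (σ : List ℕ) (n : ℕ) : (descentAvoidersTwo σ n).Finite :=
  (finite_descentAvoiders σ n).subset fun _ h => h.1

theorem avoidsBoth_nil : AvoidsBoth [] :=
  ⟨by simp [IsPermList], by simp [HasTwoSmallerAfter]⟩

theorem ncard_descentAvoiders_zero (σ : List ℕ) : (descentAvoiders σ 0).ncard = 1 := by
  rw [Set.ncard_eq_one]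
  refine ⟨[], Set.ext fun l => ?_⟩
  simp only [descentAvoiders, Set.mem_ofPred_eq, Set.mem_singleton_iff, List.length_eq_zero_iff]
  refine ⟨And.left, ?_⟩
  rintro rfl
  exact ⟨rfl, avoidsBoth_nil, by simp [InvolvesDescentThen]⟩

theorem ncard_descentAvoidersTwo_one (σ : List ℕ) : (descentAvoidersTwo σ 1).ncard = 0 := by
  rw [Set.ncard_eq_zero (finite_descentAvoidersTwo σ 1), Set.eq_empty_iff_forall_notMem]
  rintro _ ⟨⟨hl, hL, _⟩, t, rfl⟩
  have := ((isPermList_iff.1 hL.1).2 2).1 (by simp)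
  omega

theorem ncard_descentAvoiders_succ (σ : List ℕ) (n : ℕ) :
    (descentAvoiders σ (n + 1)).ncard =
      (descentAvoiders σ n).ncard + (descentAvoidersTwo σ (n + 1)).ncard := by
  have h : descentAvoiders σ (n + 1) =
      consValue 1 '' descentAvoiders σ n ∪ descentAvoidersTwo σ (n + 1) := by
    ext l
    constructor
    · rintro ⟨hlen, hL, hI⟩
      obtain _ | ⟨c, t⟩ := l
      · simp at hlen
      obtain rfl | rfl := hL.head_le_two
      · obtain ⟨s, hs, hsp⟩ := hL.1.exists_eq_consValue
        rw [hs] at hlen hL hI ⊢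
        refine .inl ⟨s, ⟨by simpa [consValue] using hlen,
          (avoidsBoth_consValue (.inl rfl) (by omega)).1 hL, ?_⟩, rfl⟩
        rwa [involvesDescentThen_consValue_one hsp] at hI
      · exact .inr ⟨⟨hlen, hL, hI⟩, t, rfl⟩
    · rintro (⟨s, ⟨hlen, hL, hI⟩, rfl⟩ | hl)
      · refine ⟨by simpa [consValue] using hlen,
          (avoidsBoth_consValue (.inl rfl) (by omega)).2 hL, ?_⟩
        rwa [involvesDescentThen_consValue_one hL.1]
      · exact hl.1
  rw [h, Set.ncard_union_eq _ ((finite_descentAvoiders σ n).image _)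
    (finite_descentAvoidersTwo σ _), Set.ncard_image_of_injective _ (consValue_injective 1)]
  rw [Set.disjoint_left]
  rintro _ ⟨s, _, rfl⟩ ⟨_, t, ht⟩
  simp [consValue] at ht

theorem ncard_descentAvoidersTwo_succ (σ : List ℕ) (n : ℕ) :
    (descentAvoidersTwo σ (n + 2)).ncard =
      (avoiders σ n).ncard + (descentAvoidersTwo σ (n + 1)).ncard := by
  have h : descentAvoidersTwo σ (n + 2) =
      (consValue 2 ∘ consValue 1) '' avoiders σ n ∪
        consValue 2 '' descentAvoidersTwo σ (n + 1) := by
    ext l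
    constructor
    · rintro ⟨⟨hlen, hL, hI⟩, t, rfl⟩
      obtain ⟨s, hs, hsp⟩ := hL.1.exists_eq_consValue
      rw [hs] at hlen hL hI ⊢
      have hslen : s.length = n + 1 := by simpa [consValue] using hlen
      rw [avoidsBoth_consValue (.inr rfl) (by omega)] at hL
      obtain _ | ⟨c, u⟩ := s
      · simp at hslen
      obtain rfl | rfl := hL.head_le_two
      · obtain ⟨v, hv, hvp⟩ := hsp.exists_eq_consValue
        rw [hv] at hslen hL hI ⊢
        rw [avoidsBoth_consValue (.inl rfl) (by omega)] at hL
        rw [involvesDescentThen_consValue_two_one hvp] at hI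
        exact .inl ⟨v, ⟨by simpa [consValue] using hslen, hL, hI⟩, rfl⟩
      · rw [involvesDescentThen_consValue_two hsp] at hI
        exact .inr ⟨_, ⟨⟨hslen, hL, hI⟩, u, rfl⟩, rfl⟩
    · rintro (⟨s, ⟨hlen, hL, hI⟩, rfl⟩ | ⟨_, ⟨⟨hlen, hL, hI⟩, u, rfl⟩, rfl⟩)
      · refine ⟨⟨by simp [consValue, hlen], ?_, ?_⟩, _, rfl⟩
        · rw [Function.comp, avoidsBoth_consValue (.inr rfl) (by simp [consValue]),
            avoidsBoth_consValue (.inl rfl) (by omega)]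
          exact hL
        · rwa [Function.comp, involvesDescentThen_consValue_two_one hL.1]
      · refine ⟨⟨by simpa [consValue] using hlen, ?_, ?_⟩, _, rfl⟩
        · rwa [avoidsBoth_consValue (.inr rfl) (by omega)]
        · rwa [involvesDescentThen_consValue_two hL.1]
  rw [h, Set.ncard_union_eq _ ((finite_avoiders σ n).image _)
    ((finite_descentAvoidersTwo σ _).image _),
    Set.ncard_image_of_injective _ ((consValue_injective 2).comp (consValue_injective 1)),
    Set.ncard_image_of_injective _ (consValue_injective 2)]
  rw [Set.disjoint_left]
  rintro _ ⟨s, _, rfl⟩ ⟨_, ⟨_, t, rfl⟩, ht⟩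
  simpa [consValue] using consValue_injective 2 ht

theorem coeff_Gav (σ : List ℕ) (n : ℕ) :
    PowerSeries.coeff n (Gav σ) = ((avoiders σ n).ncard : ℚ) := by
  have h : avoiders σ n = {l | l.length = n ∧ IsPermList l ∧
      ¬ Involves [3, 1, 2] l ∧ ¬ Involves [3, 2, 1] l ∧ ¬ Involves σ l} := by
    ext l
    simp only [avoiders, AvoidsBoth, Set.mem_ofPred_eq, and_assoc]
    refine and_congr_right fun _ => and_congr_right fun hl => ?_
    rw [← avoids_312_and_321_iff (isPermList_iff.1 hl).1, and_assoc]
  rw [Gav, PowerSeries.coeff_mk, h]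
  rfl

theorem avoiders_dsum {σ : List ℕ} (hσ : ∀ a ∈ σ, 0 < a) (n : ℕ) :
    avoiders (dsum [2, 1] σ) n = descentAvoiders σ n := by
  simp only [avoiders, descentAvoiders, involves_dsum_iff hσ]

/-- The generating function identity for `21 ⊕ σ`, for an arbitrary pattern `σ`. -/
theorem Gav_dsum_two_one {σ : List ℕ} (hσ : ∀ a ∈ σ, 0 < a) :
    (1 - PowerSeries.X) ^ 2 * Gav (dsum [2, 1] σ) =
      (1 - PowerSeries.X) + PowerSeries.X ^ 2 * Gav σ := by
  set C : PowerSeries ℚ := PowerSeries.mk fun n => ((descentAvoidersTwo σ (n + 1)).ncard : ℚ)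
    with hC
  have h1 : Gav (dsum [2, 1] σ) = 1 + PowerSeries.X * (Gav (dsum [2, 1] σ) + C) := by
    ext n
    rcases n with _ | n
    · simp [coeff_Gav, avoiders_dsum hσ, ncard_descentAvoiders_zero]
    · simp [coeff_Gav, avoiders_dsum hσ, ncard_descentAvoiders_succ, hC, PowerSeries.coeff_one,
        PowerSeries.coeff_succ_X_mul]
  have h2 : C = PowerSeries.X * (Gav σ + C) := by
    ext n
    rcases n with _ | n
    · simp [hC, ncard_descentAvoidersTwo_one]
    · rw [PowerSeries.coeff_succ_X_mul]
      simp [coeff_Gav, hC, ncard_descentAvoidersTwo_succ]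
  linear_combination (1 - PowerSeries.X) * h1 + PowerSeries.X * h2

/-- `(1 − X)² G_{21⊕β_k} = (1 − X) + X² G_{β_k}`. -/
theorem gf_b2bk (k : ℕ) (hk : 2 ≤ k) :
    (1 - PowerSeries.X) ^ 2 * Gav (dsum [2, 1] (beta k))
      = (1 - PowerSeries.X) + PowerSeries.X ^ 2 * Gav (beta k) := by
  refine Gav_dsum_two_one fun a ha => ?_
  simp only [beta, List.mem_append, List.mem_map, List.mem_singleton] at ha
  omega
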